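/- arXiv:1209.5096 — 2 statements merged into one kernel-verified Lean document; each statement's English description precedes it below -/
import Mathlib

section
/- Let U be a semiring containing 0 and 1 which has no zero divisors. Suppose A = RS and B = SR is an elementary strong shift equivalence over U in which A, B, R, S are all nondegenerate. Then there exist nondegenerate matrices C₁, C₂, D over U with D diagonal such that: (1) C₁ is an elementary row splitting of A over U; (2) there is a matrix X over U with DX = C₁ and XD = C₂; and (3) C₂ is an elementary column splitting of B over U. -/
open Matrix

/-- A matrix is nondegenerate if it has no zero row and no zero column. -/
def Nondeg {R : Type*} [Zero R] {m n : ℕ} (A : Matrix (Fin m) (Fin n) R) : Prop :=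
  (∀ i, ∃ j, A i j ≠ 0) ∧ (∀ j, ∃ i, A i j ≠ 0)

/-- An amalgamation matrix: a 0-1 matrix with exactly one 1 in each row and at
least one 1 in each column. -/
def IsAmalgamation {R : Type*} [Semiring R] {m n : ℕ} (V : Matrix (Fin m) (Fin n) R) : Prop :=
  (∀ i j, V i j = 0 ∨ V i j = 1) ∧ (∀ i, ∃! j, V i j = 1) ∧ (∀ j, ∃ i, V i j = 1)

/-- A subdivision matrix is the transpose of an amalgamation matrix. -/
def IsSubdivision {R : Type*} [Semiring R] {m n : ℕ} (U₀ : Matrix (Fin m) (Fin n) R) : Prop :=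
  IsAmalgamation U₀ᵀ

/-- `C` is an elementary row splitting over `R` of the square matrix `A`. -/
def RowSplitting {R : Type*} [Semiring R] {m k : ℕ}
    (A : Matrix (Fin m) (Fin m) R) (C : Matrix (Fin k) (Fin k) R) : Prop :=
  ∃ (U₀ : Matrix (Fin m) (Fin k) R) (X : Matrix (Fin k) (Fin m) R),
    IsSubdivision U₀ ∧ A = U₀ * X ∧ C = X * U₀

/-- `C` is an elementary column splitting over `R` of the square matrix `A`. -/
def ColSplitting {R : Type*} [Semiring R] {m k : ℕ}
    (A : Matrix (Fin m) (Fin m) R) (C : Matrix (Fin k) (Fin k) R) : Prop :=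
  ∃ (X : Matrix (Fin m) (Fin k) R) (V : Matrix (Fin k) (Fin m) R),
    IsAmalgamation V ∧ A = X * V ∧ C = V * X

/-- The entries in the support of a finite matrix can be enumerated without repetition. -/
theorem exists_support_enumeration {R : Type*} [Zero R] {m k : ℕ}
    (A : Matrix (Fin m) (Fin k) R) :
    ∃ (p : ℕ) (a : Fin p → Fin m) (b : Fin p → Fin k),
      (∀ e, A (a e) (b e) ≠ 0) ∧
      (∀ i j, A i j ≠ 0 → ∃ e, a e = i ∧ b e = j) ∧
      (∀ e f, a e = a f → b e = b f → e = f) := by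
  classical
  let E := {e : Fin m × Fin k // A e.1 e.2 ≠ 0}
  let σ : Fin (Fintype.card E) ≃ E := (Fintype.equivFin E).symm
  refine ⟨Fintype.card E, fun e => (σ e).1.1, fun e => (σ e).1.2, fun e => (σ e).2, ?_, ?_⟩
  · intro i j h
    exact ⟨σ.symm ⟨(i, j), h⟩, by simp, by simp⟩
  · intro e f h₁ h₂
    exact σ.injective (Subtype.ext (Prod.ext h₁ h₂))

/-- The indicator matrix of the graph of a function. -/
def graphMatrix (R : Type*) [Semiring R] {p n : ℕ} (g : Fin p → Fin n) :
    Matrix (Fin p) (Fin n) R :=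
  Matrix.of fun e j => if g e = j then 1 else 0

/-- Over a nontrivial semiring the graph of a surjection is an amalgamation matrix. -/
theorem isAmalgamation_graphMatrix {R : Type*} [Semiring R] {p n : ℕ} (g : Fin p → Fin n)
    (hg : Function.Surjective g) (h : Fin p → (1 : R) ≠ 0) :
    IsAmalgamation (graphMatrix R g) := by
  refine ⟨fun e j => ?_, fun e => ⟨g e, by simp [graphMatrix], fun j hj => ?_⟩, fun j => ?_⟩
  · by_cases hj : g e = j <;> simp [graphMatrix, hj]
  · by_contra hne
    have : (0 : R) = 1 := by simpa [graphMatrix, Ne.symm hne] using hj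
    exact h e this.symm
  · obtain ⟨e, rfl⟩ := hg j
    exact ⟨e, by simp [graphMatrix]⟩

/-- Left multiplication by a graph matrix pulls back rows. -/
theorem graphMatrix_mul_apply {R : Type*} [Semiring R] {p n l : ℕ} (g : Fin p → Fin n)
    (M : Matrix (Fin n) (Fin l) R) (e : Fin p) (j : Fin l) :
    (graphMatrix R g * M) e j = M (g e) j := by
  simp [graphMatrix, Matrix.mul_apply]

/-- Right multiplication by a transposed graph matrix pulls back columns. -/
theorem mul_graphMatrix_transpose_apply {R : Type*} [Semiring R] {p n l : ℕ}
    (g : Fin p → Fin n) (M : Matrix (Fin l) (Fin n) R) (i : Fin l) (e : Fin p) :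
    (M * (graphMatrix R g)ᵀ) i e = M i (g e) := by
  simp [graphMatrix, Matrix.mul_apply]

/-- A matrix factors through the diagonal matrix of its nonzero entries. -/
theorem graphMatrix_transpose_mul_diagonal_mul {R : Type*} [Semiring R] {m k p : ℕ}
    (A : Matrix (Fin m) (Fin k) R) (a : Fin p → Fin m) (b : Fin p → Fin k)
    (hex : ∀ i j, A i j ≠ 0 → ∃ e, a e = i ∧ b e = j)
    (hinj : ∀ e f, a e = a f → b e = b f → e = f) :
    (graphMatrix R a)ᵀ * (diagonal (fun e => A (a e) (b e)) * graphMatrix R b) = A := by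
  ext i j
  simp only [Matrix.mul_apply (M := (graphMatrix R a)ᵀ), diagonal_mul, transpose_apply]
  by_cases h : A i j = 0
  · rw [h]
    refine Finset.sum_eq_zero fun e _ => ?_
    by_cases h₁ : a e = i <;> by_cases h₂ : b e = j <;> simp [graphMatrix, h₁, h₂, h]
  · obtain ⟨e, rfl, rfl⟩ := hex i j h
    rw [Finset.sum_eq_single e]
    · simp [graphMatrix]
    · intro f _ hf
      by_cases h₁ : a f = a e
      · have h₂ : b f ≠ b e := fun h₂ => hf (hinj f e h₁ h₂)
        simp [graphMatrix, h₂]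
      · simp [graphMatrix, h₁]
    · simp

/-- A nondegenerate elementary strong shift equivalence over a semiring with no zero
divisors decomposes into an elementary row splitting, a diagonal refactorization, and
an elementary column splitting. -/
theorem decomposition (R : Type*) [Semiring R] [NoZeroDivisors R]
    {m k : ℕ} (A : Matrix (Fin m) (Fin m) R) (B : Matrix (Fin k) (Fin k) R)
    (Rm : Matrix (Fin m) (Fin k) R) (Sm : Matrix (Fin k) (Fin m) R)
    (hA : A = Rm * Sm) (hB : B = Sm * Rm)
    (hAnd : Nondeg A) (hBnd : Nondeg B) (hRnd : Nondeg Rm) (hSnd : Nondeg Sm) :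
    ∃ (p : ℕ) (C₁ C₂ D : Matrix (Fin p) (Fin p) R),
      Nondeg C₁ ∧ Nondeg C₂ ∧ Nondeg D ∧ D.IsDiag ∧
      RowSplitting A C₁ ∧
      (∃ X : Matrix (Fin p) (Fin p) R, D * X = C₁ ∧ X * D = C₂) ∧
      ColSplitting B C₂ := by
  obtain ⟨p, a, b, hne, hex, hinj⟩ := exists_support_enumeration Rm
  have ha : Function.Surjective a := fun i => by
    obtain ⟨j, hj⟩ := hRnd.1 i
    obtain ⟨e, he, -⟩ := hex i j hj
    exact ⟨e, he⟩
  have hb : Function.Surjective b := fun j => by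
    obtain ⟨i, hi⟩ := hRnd.2 j
    obtain ⟨e, -, he⟩ := hex i j hi
    exact ⟨e, he⟩
  have h₁ : Fin p → (1 : R) ≠ 0 := fun e h => hne e (eq_zero_of_zero_eq_one h.symm _)
  have hfac := graphMatrix_transpose_mul_diagonal_mul Rm a b hex hinj
  set D : Matrix (Fin p) (Fin p) R := diagonal fun e => Rm (a e) (b e) with hD
  set X : Matrix (Fin p) (Fin p) R := graphMatrix R b * Sm * (graphMatrix R a)ᵀ with hX
  have hX_apply : ∀ e f, X e f = Sm (b e) (a f) := fun e f => by
    rw [hX, mul_graphMatrix_transpose_apply, graphMatrix_mul_apply]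
  have hXnd : Nondeg X := by
    refine ⟨fun e => ?_, fun f => ?_⟩
    · obtain ⟨i, hi⟩ := hSnd.1 (b e)
      obtain ⟨f, rfl⟩ := ha i
      exact ⟨f, by rwa [hX_apply]⟩
    · obtain ⟨j, hj⟩ := hSnd.2 (a f)
      obtain ⟨e, rfl⟩ := hb j
      exact ⟨e, by rwa [hX_apply]⟩
  refine ⟨p, D * X, X * D, D, ⟨fun e => ?_, fun f => ?_⟩, ⟨fun e => ?_, fun f => ?_⟩,
    ⟨fun e => ⟨e, ?_⟩, fun e => ⟨e, ?_⟩⟩, isDiag_diagonal _,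
    ⟨(graphMatrix R a)ᵀ, D * graphMatrix R b * Sm, ?_, ?_, ?_⟩, ⟨X, rfl, rfl⟩,
    ⟨Sm * (graphMatrix R a)ᵀ * D, graphMatrix R b, isAmalgamation_graphMatrix b hb h₁, ?_, ?_⟩⟩
  · obtain ⟨f, hf⟩ := hXnd.1 e
    exact ⟨f, by rw [hD, diagonal_mul]; exact mul_ne_zero (hne e) hf⟩
  · obtain ⟨e, he⟩ := hXnd.2 f
    exact ⟨e, by rw [hD, diagonal_mul]; exact mul_ne_zero (hne e) he⟩
  · obtain ⟨f, hf⟩ := hXnd.1 e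
    exact ⟨f, by rw [hD, mul_diagonal]; exact mul_ne_zero hf (hne f)⟩
  · obtain ⟨e, he⟩ := hXnd.2 f
    exact ⟨e, by rw [hD, mul_diagonal]; exact mul_ne_zero he (hne f)⟩
  · rw [hD, diagonal_apply_eq]; exact hne e
  · rw [hD, diagonal_apply_eq]; exact hne e
  · rw [IsSubdivision, transpose_transpose]
    exact isAmalgamation_graphMatrix a ha h₁
  · rw [← Matrix.mul_assoc, hfac, hA]
  · simp only [hX, Matrix.mul_assoc]
  · rw [hB, ← hfac]
    simp only [Matrix.mul_assoc]
  · simp only [hX, Matrix.mul_assoc]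
end

section
/- Let U be a dense unital subring of ℝ which contains an ideal J ≠ U such that every element of U outside J is a unit of U. Let A be an n×n matrix with entries in U. Then every connected component of Cent_ℝ(A) contains a matrix W such that both W and W⁻¹ have all entries in U. -/
open Matrix

/-- All entries of a real matrix lie in the set `S`. -/
def entriesIn {n : ℕ} (S : Set ℝ) (A : Matrix (Fin n) (Fin n) ℝ) : Prop :=
  ∀ i j, A i j ∈ S

/-- The centralizer of `A` in `GL(n,ℝ)`, as a set of matrices. -/
def CentR {n : ℕ} (A : Matrix (Fin n) (Fin n) ℝ) : Set (Matrix (Fin n) (Fin n) ℝ) :=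
  {B | IsUnit B ∧ A * B = B * A}

open Topology

theorem Subring.exists_common_denominator (U : Subring ℝ) {ι : Type*} (s : Finset ι) (f : ι → ℝ)
    (hf : ∀ i ∈ s, f i ∈ Subfield.closure (U : Set ℝ)) :
    ∃ d ∈ U, d ≠ 0 ∧ ∀ i ∈ s, d * f i ∈ U := by
  classical
  induction s using Finset.induction_on with
  | empty => exact ⟨1, U.one_mem, one_ne_zero, by simp⟩
  | insert a s _ ih =>
    obtain ⟨d, hd, hd0, hds⟩ := ih fun i hi => hf i (Finset.mem_insert_of_mem hi)
    obtain ⟨y, hy, z, hz, hyz⟩ := Subfield.mem_closure_iff.1 (hf a (Finset.mem_insert_self a s))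
    rw [Subring.closure_eq] at hy hz
    by_cases hz0 : z = 0
    · refine ⟨d, hd, hd0, fun i hi => ?_⟩
      rcases Finset.mem_insert.1 hi with rfl | hi
      · simp [← hyz, hz0]
      · exact hds i hi
    · refine ⟨d * z, U.mul_mem hd hz, mul_ne_zero hd0 hz0, fun i hi => ?_⟩
      rcases Finset.mem_insert.1 hi with rfl | hi
      · have h : d * z * f i = d * y := by
          rw [← hyz]
          field_simp
        exact h ▸ U.mul_mem hd hy
      · have h : d * z * f i = z * (d * f i) := by ring
        exact h ▸ U.mul_mem hz (hds i hi)

/-- The matrices commuting with `A` whose entries lie in the ideal `I` of `U`. -/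
def commutingEntriesIn {n : ℕ} {U : Subring ℝ} (I : Ideal U) (A : Matrix (Fin n) (Fin n) ℝ) :
    AddSubgroup (Matrix (Fin n) (Fin n) ℝ) where
  carrier := {Y | A * Y = Y * A ∧ ∀ i j, ∃ u ∈ I, (u : ℝ) = Y i j}
  zero_mem' := ⟨by simp, fun _ _ => ⟨0, I.zero_mem, rfl⟩⟩
  add_mem' := by
    rintro X Y ⟨hX, hX'⟩ ⟨hY, hY'⟩
    refine ⟨by rw [mul_add, add_mul, hX, hY], fun i j => ?_⟩
    obtain ⟨u, hu, hu'⟩ := hX' i j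
    obtain ⟨v, hv, hv'⟩ := hY' i j
    exact ⟨u + v, I.add_mem hu hv, by simp [hu', hv']⟩
  neg_mem' := by
    rintro X ⟨hX, hX'⟩
    refine ⟨by rw [mul_neg, neg_mul, hX], fun i j => ?_⟩
    obtain ⟨u, hu, hu'⟩ := hX' i j
    exact ⟨-u, I.neg_mem hu, by simp [hu']⟩

/-- A real multiple of a `U`-matrix commuting with `A` is a limit of commuting `I`-matrices. -/
theorem smul_mem_topologicalClosure {n : ℕ} {U : Subring ℝ} {I : Ideal U}
    (hI : Dense ((↑) '' (I : Set U) : Set ℝ)) {A Y : Matrix (Fin n) (Fin n) ℝ}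
    (hY : A * Y = Y * A) (hYU : entriesIn (U : Set ℝ) Y) (t : ℝ) :
    t • Y ∈ (commutingEntriesIn I A).topologicalClosure := by
  have hcont : Continuous fun s : ℝ => s • Y := by fun_prop
  refine map_mem_closure (f := fun s : ℝ => s • Y) hcont (hI t) ?_
  rintro _ ⟨u, hu, rfl⟩
  refine ⟨by rw [mul_smul_comm, smul_mul_assoc, hY], fun i j => ?_⟩
  exact ⟨u * ⟨Y i j, hYU i j⟩, I.mul_mem_right _ hu, by simp⟩

theorem mem_topologicalClosure_commutingEntriesIn {n : ℕ} {U : Subring ℝ} {I : Ideal U}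
    (hI : Dense ((↑) '' (I : Set U) : Set ℝ)) {A X : Matrix (Fin n) (Fin n) ℝ}
    (hAU : entriesIn (U : Set ℝ) A) (hX : A * X = X * A) :
    X ∈ (commutingEntriesIn I A).topologicalClosure := by
  classical
  let K := Subfield.closure (U : Set ℝ)
  have hUK : ∀ i j, A i j ∈ K := fun i j => Subfield.subset_closure (hAU i j)
  let b := Module.Basis.ofVectorSpace K ℝ
  let Y : Module.Basis.ofVectorSpaceIndex K ℝ → Matrix (Fin n) (Fin n) ℝ :=
    fun k => X.map fun x => (b.repr x k : ℝ)
  have hY : ∀ k, A * Y k = Y k * A := by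
    intro k
    have hl : ∀ i j x, (b.repr (A i j * x) k : ℝ) = A i j * b.repr x k := by
      intro i j x
      have h := congrArg (fun f => (f k : ℝ)) (b.repr.map_smul (⟨A i j, hUK i j⟩ : K) x)
      exact h
    ext i j
    have h := congrArg (fun M : Matrix (Fin n) (Fin n) ℝ => (b.repr (M i j) k : ℝ)) hX
    simp only [Matrix.mul_apply, map_sum, Finsupp.coe_finsetSum, Finset.sum_apply,
      AddSubmonoidClass.coe_finsetSum, hl] at h
    simp only [mul_comm (X i _), hl] at h
    simpa [Matrix.mul_apply, Y, mul_comm] using h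
  let s : Finset (Module.Basis.ofVectorSpaceIndex K ℝ) :=
    Finset.univ.biUnion fun p : Fin n × Fin n => (b.repr (X p.1 p.2)).support
  have hXsum : X = ∑ k ∈ s, (b k : ℝ) • Y k := by
    ext i j
    have hs : (b.repr (X i j)).support ⊆ s :=
      Finset.subset_biUnion_of_mem (fun p : Fin n × Fin n => (b.repr (X p.1 p.2)).support)
        (Finset.mem_univ (i, j))
    have h := b.linearCombination_repr (X i j)
    rw [Finsupp.linearCombination_apply, Finsupp.sum_of_support_subset _ hs _ (by simp)] at h
    rw [Matrix.sum_apply]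
    refine h.symm.trans (Finset.sum_congr rfl fun k _ => ?_)
    exact mul_comm _ _
  rw [hXsum]
  refine sum_mem fun k _ => ?_
  obtain ⟨d, -, hd0, hd⟩ := U.exists_common_denominator Finset.univ
    (fun p : Fin n × Fin n => Y k p.1 p.2) fun p _ => (b.repr (X p.1 p.2) k).2
  have h : b k • Y k = (b k * d⁻¹) • d • Y k := by
    rw [smul_smul, mul_assoc, inv_mul_cancel₀ hd0, mul_one]
  rw [h]
  have hdY : A * (d • Y k) = (d • Y k) * A := by rw [mul_smul_comm, smul_mul_assoc, hY]
  exact smul_mem_topologicalClosure hI hdY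
    (fun i j => hd (i, j) (Finset.mem_univ _)) _

theorem dense_image_ideal {U : Subring ℝ} (hU : Dense (U : Set ℝ)) {I : Ideal U} (hI : I ≠ ⊥) :
    Dense ((↑) '' (I : Set U) : Set ℝ) := by
  obtain ⟨c, hc, hc0⟩ := Submodule.exists_mem_ne_zero_of_ne_bot hI
  have hc0' : (c : ℝ) ≠ 0 := by simpa using hc0
  have hsurj : Function.Surjective fun x : ℝ => (c : ℝ) * x :=
    (mulLeft_bijective₀ (c : ℝ) hc0').surjective
  refine (hsurj.denseRange.dense_image (by fun_prop) hU).mono ?_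
  rintro _ ⟨x, hx, rfl⟩
  exact ⟨c * ⟨x, hx⟩, I.mul_mem_right _ hc, rfl⟩

/-- Matrices commuting with `A` and close to `B` lie in the component of `B`. -/
theorem exists_nhds_subset_connectedComponentIn {n : ℕ} {A B : Matrix (Fin n) (Fin n) ℝ}
    (hB : B ∈ CentR A) :
    ∃ V ∈ 𝓝 B, ∀ W ∈ V, A * W = W * A → IsUnit W ∧ W ∈ connectedComponentIn (CentR A) B := by
  have hopen : {M : Matrix (Fin n) (Fin n) ℝ | M.det ≠ 0} ∈ 𝓝 B :=
    (isOpen_ne.preimage (by fun_prop : Continuous fun M : Matrix (Fin n) (Fin n) ℝ =>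
      M.det)).mem_nhds ((Matrix.isUnit_iff_isUnit_det B).1 hB.1).ne_zero
  have hunit : ∀ M : Matrix (Fin n) (Fin n) ℝ, M.det ≠ 0 → IsUnit M := fun M hM =>
    (Matrix.isUnit_iff_isUnit_det M).2 hM.isUnit
  have : LocallyConvexSpace ℝ (Matrix (Fin n) (Fin n) ℝ) :=
    inferInstanceAs (LocallyConvexSpace ℝ (Fin n → Fin n → ℝ))
  obtain ⟨V, ⟨hV, hconv⟩, hVsub⟩ :=
    (LocallyConvexSpace.convex_basis (𝕜 := ℝ) B).mem_iff.1 hopen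
  refine ⟨V, hV, fun W hW hAW => ⟨hunit W (hVsub hW), ?_⟩⟩
  have hconv' : Convex ℝ (V ∩ {M | A * M = M * A}) := by
    refine hconv.inter ?_
    intro M hM N hN a b _ _ _
    simp only [Set.mem_ofPred_eq] at hM hN ⊢
    simp only [mul_add, add_mul, mul_smul_comm, smul_mul_assoc, hM, hN]
  have hsub : V ∩ {M | A * M = M * A} ⊆ CentR A := fun M hM => ⟨hunit M (hVsub hM.1), hM.2⟩
  exact hconv'.isPreconnected.subset_connectedComponentIn ⟨mem_of_mem_nhds hV, hB.2⟩ hsub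
    ⟨hW, hAW⟩

theorem exists_inverse_of_isUnit_det {n : ℕ} {U : Subring ℝ} {W : Matrix (Fin n) (Fin n) U}
    (hW : IsUnit W.det) :
    ∃ Winv : Matrix (Fin n) (Fin n) ℝ, W.map U.subtype * Winv = 1 ∧ Winv * W.map U.subtype = 1 ∧
      entriesIn (U : Set ℝ) (W.map U.subtype) ∧ entriesIn (U : Set ℝ) Winv := by
  refine ⟨W⁻¹.map U.subtype, ?_, ?_, fun i j => (W i j).2, fun i j => (W⁻¹ i j).2⟩
  · rw [← Matrix.map_mul, Matrix.mul_nonsing_inv _ hW, Matrix.map_one _ (map_zero _) (map_one _)]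
  · rw [← Matrix.map_mul, Matrix.nonsing_inv_mul _ hW, Matrix.map_one _ (map_zero _) (map_one _)]

theorem exists_mem_isUnit_det {U : Subring ℝ} (hU : Dense (U : Set ℝ))
    {J : Ideal U} (hJ : J ≠ ⊤) (hJunit : ∀ x : U, x ∉ J → IsUnit x)
    {n : ℕ} {A B : Matrix (Fin n) (Fin n) ℝ} (hAU : entriesIn (U : Set ℝ) A)
    (hB : A * B = B * A) {V : Set (Matrix (Fin n) (Fin n) ℝ)} (hV : V ∈ 𝓝 B)
    (hVunit : ∀ W ∈ V, A * W = W * A → IsUnit W) :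
    ∃ W : Matrix (Fin n) (Fin n) U, W.map U.subtype ∈ V ∧
      A * W.map U.subtype = W.map U.subtype * A ∧ IsUnit W.det := by
  by_cases hJ0 : J = ⊥
  · obtain ⟨Y, hYV, hY, hYU⟩ := mem_closure_iff_nhds.1 (mem_topologicalClosure_commutingEntriesIn
      (dense_image_ideal hU (top_ne_bot (α := Ideal U))) hAU hB) V hV
    choose W _ hW' using hYU
    obtain rfl : (Matrix.of W).map U.subtype = Y := by ext i j; exact hW' i j
    refine ⟨Matrix.of W, hYV, hY, hJunit _ ?_⟩
    intro h
    rw [hJ0, Ideal.mem_bot] at h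
    have h' := ((Matrix.isUnit_iff_isUnit_det _).1 (hVunit _ hYV hY)).ne_zero
    exact h' ((RingHom.map_det U.subtype (Matrix.of W)).symm.trans (by rw [h, map_zero]))
  · have hV' : (fun Y => 1 + Y) ⁻¹' V ∈ 𝓝 (B - 1) := by
      refine (by fun_prop : Continuous fun Y : Matrix (Fin n) (Fin n) ℝ => 1 + Y).continuousAt ?_
      simpa using hV
    obtain ⟨Y, hYV, hY, hYU⟩ := mem_closure_iff_nhds.1 (mem_topologicalClosure_commutingEntriesIn
      (dense_image_ideal hU hJ0) hAU
      (by rw [mul_sub, sub_mul, hB, mul_one, one_mul] : A * (B - 1) = (B - 1) * A)) _ hV'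
    choose Z hZ hZ' using hYU
    have hmap : (1 + Matrix.of Z).map U.subtype = 1 + Y := by
      rw [Matrix.map_add _ (map_add _), Matrix.map_one _ (map_zero _) (map_one _)]
      congr 1
      ext i j
      exact hZ' i j
    refine ⟨1 + Matrix.of Z, hmap ▸ hYV, ?_, hJunit _ ?_⟩
    · rw [hmap, mul_add, add_mul, hY, mul_one, one_mul]
    · intro h
      have : Nontrivial (U ⧸ J) := Ideal.Quotient.nontrivial_iff.2 hJ
      have hmod : (Ideal.Quotient.mk J).mapMatrix (1 + Matrix.of Z) = 1 := by
        have hZ0 : (Ideal.Quotient.mk J).mapMatrix (Matrix.of Z) = 0 := by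
          ext i j
          exact Ideal.Quotient.eq_zero_iff_mem.2 (hZ i j)
        rw [map_add, map_one, hZ0, add_zero]
      have hdet := RingHom.map_det (Ideal.Quotient.mk J) (1 + Matrix.of Z)
      rw [hmod, Matrix.det_one, Ideal.Quotient.eq_zero_iff_mem.2 h] at hdet
      exact zero_ne_one hdet

/-- Centralizer Lemma: if `U` is a dense unital subring of `ℝ` containing a proper
ideal `J` such that every element of `U` outside `J` is a unit of `U`, and `A` is a
matrix over `U`, then every connected component of `Cent_ℝ(A)` contains a matrix `W`
such that `W` and `W⁻¹` have all entries in `U`. -/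
theorem centralizer_lemma (U : Subring ℝ) (hU : Dense (U : Set ℝ))
    (J : Ideal U) (hJ : J ≠ ⊤) (hJunit : ∀ x : U, x ∉ J → IsUnit x)
    {n : ℕ} (A : Matrix (Fin n) (Fin n) ℝ) (hAU : entriesIn (U : Set ℝ) A) :
    ∀ B ∈ CentR A, ∃ W ∈ connectedComponentIn (CentR A) B,
      ∃ Winv : Matrix (Fin n) (Fin n) ℝ,
        W * Winv = 1 ∧ Winv * W = 1 ∧
        entriesIn (U : Set ℝ) W ∧ entriesIn (U : Set ℝ) Winv := by
  intro B hB
  obtain ⟨V, hV, hVB⟩ := exists_nhds_subset_connectedComponentIn hB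
  obtain ⟨W, hWV, hAW, hW⟩ := exists_mem_isUnit_det hU hJ hJunit hAU hB.2 hV
    fun W hWV hAW => (hVB W hWV hAW).1
  exact ⟨W.map U.subtype, (hVB _ hWV hAW).2, exists_inverse_of_isUnit_det hW⟩
end
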